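/- arXiv:2512.07685 — 11 statements merged into one kernel-verified Lean document; each statement's English description precedes it below -/
import Mathlib

section
/- Let (Q, ≤, ·) be a monoidal quasi-order with neutral element e such that the strict relation x < y ↔ (x ≤ y ∧ ¬ y ≤ x) is well-founded. Then every q ∈ Q is equivalent to a finite product of primes: there exist n ∈ ℕ and primes p₀, …, p_{n−1} ∈ Q with q ≡ p₀·…·p_{n−1}, where the empty product (n = 0) is e. -/
/-- `x ≡ y`: the equivalence induced by a quasi-order. -/
def Equi {Q : Type*} (le : Q → Q → Prop) (x y : Q) : Prop := le x y ∧ le y x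

/-- `p` is prime: not equivalent to the neutral element `e`, and
`p ≡ a·b` implies `p ≡ a` or `p ≡ b`. -/
def PrimeEl {Q : Type*} (le : Q → Q → Prop) (mul : Q → Q → Q) (e : Q) (p : Q) : Prop :=
  ¬ Equi le p e ∧ ∀ a b : Q, Equi le p (mul a b) → Equi le p a ∨ Equi le p b

/-- The product of a finite list of elements, with the empty product being `e`. -/
def ProdL {Q : Type*} (mul : Q → Q → Q) (e : Q) : List Q → Q
  | [] => e
  | [a] => a
  | a :: b :: rest => mul a (ProdL mul e (b :: rest))

theorem Equi.trans_of {Q : Type*} {le : Q → Q → Prop}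
    (htrans : ∀ x y z, le x y → le y z → le x z) {x y z : Q}
    (hxy : Equi le x y) (hyz : Equi le y z) : Equi le x z :=
  ⟨htrans _ _ _ hxy.1 hyz.1, htrans _ _ _ hyz.2 hxy.2⟩

theorem prodL_cons_equi {Q : Type*} {le : Q → Q → Prop} {mul : Q → Q → Q} {e : Q}
    (hrefl : ∀ x, le x x) (hneut : ∀ q, Equi le (mul q e) q) (a : Q) (l : List Q) :
    Equi le (ProdL mul e (a :: l)) (mul a (ProdL mul e l)) := by
  cases l with
  | nil => exact ⟨(hneut a).2, (hneut a).1⟩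
  | cons b l => exact ⟨hrefl _, hrefl _⟩

theorem prodL_append_equi {Q : Type*} {le : Q → Q → Prop} {mul : Q → Q → Q} {e : Q}
    (hrefl : ∀ x, le x x)
    (htrans : ∀ x y z, le x y → le y z → le x z)
    (hassoc : ∀ p q r, Equi le (mul (mul p q) r) (mul p (mul q r)))
    (hmono : ∀ q p q' p', le q q' → le p p' → le (mul q p) (mul q' p'))
    (hneut : ∀ q, Equi le (mul e q) q ∧ Equi le (mul q e) q) (l m : List Q) :
    Equi le (mul (ProdL mul e l) (ProdL mul e m)) (ProdL mul e (l ++ m)) := by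
  induction l with
  | nil => exact (hneut _).1
  | cons a l ih =>
    have hl := prodL_cons_equi hrefl (fun q => (hneut q).2) a l
    have hlm := prodL_cons_equi hrefl (fun q => (hneut q).2) a (l ++ m)
    have hl' : Equi le (mul (ProdL mul e (a :: l)) (ProdL mul e m))
        (mul (mul a (ProdL mul e l)) (ProdL mul e m)) :=
      ⟨hmono _ _ _ _ hl.1 (hrefl _), hmono _ _ _ _ hl.2 (hrefl _)⟩
    have ih' : Equi le (mul a (mul (ProdL mul e l) (ProdL mul e m)))
        (mul a (ProdL mul e (l ++ m))) :=
      ⟨hmono _ _ _ _ (hrefl _) ih.1, hmono _ _ _ _ (hrefl _) ih.2⟩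
    exact hl'.trans_of htrans ((hassoc _ _ _).trans_of htrans
      (ih'.trans_of htrans ⟨hlm.2, hlm.1⟩))

/-- In a monoidal quasi-order whose strict order is well-founded,
every element is equivalent to a finite product of primes. -/
theorem stmt0 {Q : Type*} (le : Q → Q → Prop) (mul : Q → Q → Q) (e : Q)
    (hrefl : ∀ x, le x x)
    (htrans : ∀ x y z, le x y → le y z → le x z)
    (hassoc : ∀ p q r, Equi le (mul (mul p q) r) (mul p (mul q r)))
    (hincr : ∀ q p, le q (mul q p))
    (hmono : ∀ q p q' p', le q q' → le p p' → le (mul q p) (mul q' p'))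
    (hneut : ∀ q, Equi le (mul e q) q ∧ Equi le (mul q e) q)
    (hwf : WellFounded (fun x y => le x y ∧ ¬ le y x)) :
    ∀ q : Q, ∃ l : List Q, (∀ p ∈ l, PrimeEl le mul e p) ∧ Equi le q (ProdL mul e l) := by
  intro q
  induction q using hwf.induction with
  | _ q ih =>
    by_cases hq : Equi le q e
    · exact ⟨[], by simp, hq⟩
    by_cases hp : PrimeEl le mul e q
    · exact ⟨[q], by simpa using hp, hrefl q, hrefl q⟩
    obtain ⟨a, b, hab, hqa, hqb⟩ :
        ∃ a b, Equi le q (mul a b) ∧ ¬ Equi le q a ∧ ¬ Equi le q b := by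
      by_contra! h
      exact hp ⟨hq, fun a b hab => or_iff_not_imp_left.2 (h a b hab)⟩
    have he : le e a := htrans _ _ _ (hincr e a) (hneut a).1.1
    have haq : le a q := htrans _ _ _ (hincr a b) hab.2
    have hbq : le b q :=
      htrans _ _ _ (hneut b).1.2 (htrans _ _ _ (hmono _ _ _ _ he (hrefl b)) hab.2)
    obtain ⟨l, hl, hal⟩ := ih a ⟨haq, fun h => hqa ⟨h, haq⟩⟩
    obtain ⟨m, hm, hbm⟩ := ih b ⟨hbq, fun h => hqb ⟨h, hbq⟩⟩
    refine ⟨l ++ m, fun p hp => (List.mem_append.1 hp).elim (hl p) (hm p), ?_⟩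
    have hmul : Equi le (mul a b) (mul (ProdL mul e l) (ProdL mul e m)) :=
      ⟨hmono _ _ _ _ hal.1 hbm.1, hmono _ _ _ _ hal.2 hbm.2⟩
    exact hab.trans_of htrans
      (hmul.trans_of htrans (prodL_append_equi hrefl htrans hassoc hmono hneut l m))
end

section
/- Let (Q, ≤) be a well quasi-order. Then inclusion on the downward-closed subsets of Q is well-founded: there is no sequence (D_k)_{k ∈ ℕ} of downward-closed subsets of Q with D_{k+1} ⊊ D_k for all k. -/
/-- `D` is downward-closed with respect to `le`. -/
def DownCl {Q : Type*} (le : Q → Q → Prop) (D : Set Q) : Prop :=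
  ∀ q d, le q d → d ∈ D → q ∈ D

/-- In a well quasi-order, inclusion on downward-closed sets is well-founded: there is
no strictly descending sequence of downward-closed sets. -/
theorem stmt4 {Q : Type*} (le : Q → Q → Prop)
    (hrefl : ∀ x, le x x)
    (htrans : ∀ x y z, le x y → le y z → le x z)
    (hwqo : ∀ f : ℕ → Q, ∃ i j, i < j ∧ le (f i) (f j)) :
    ¬ ∃ D : ℕ → Set Q, (∀ k, DownCl le (D k)) ∧ ∀ k, D (k + 1) ⊂ D k := by
  rintro ⟨D, hD, hlt⟩
  choose x hx hx' using fun k => Set.exists_of_ssubset (hlt k)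
  obtain ⟨i, j, hij, hle⟩ := hwqo x
  have hanti : Antitone D := antitone_nat_of_succ_le fun k => (hlt k).subset
  exact hx' i (hD (i + 1) _ _ hle (hanti hij (hx j)))
end

section
/- Let (Q, ≤, ·) be a monoidal well quasi-order with the +-property, and let A, B, C be nonempty downward-closed subsets of Q with C ⊆ A•B. Then there exist n ∈ ℕ and nonempty downward-closed sets A₀, …, A_{n−1} and B₀, …, B_{n−1} such that Aᵢ ⊆ A and Bᵢ ⊆ B for every i < n, and C = ⋃_{i<n} Aᵢ•Bᵢ. -/
/-- The product `A•B` of two subsets of a multiplicative quasi-order. -/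
def Bullet {Q : Type*} (le : Q → Q → Prop) (mul : Q → Q → Q) (A B : Set Q) : Set Q :=
  {z : Q | ∃ a ∈ A, ∃ b ∈ B, le z (mul a b)}

/-- An antitone map from a well quasi-order to its downward-closed subsets has finite range. -/
theorem finite_range_of_antitone_downCl {Q : Type*} (le : Q → Q → Prop)
    (htrans : ∀ x y z, le x y → le y z → le x z)
    (hwqo : ∀ f : ℕ → Q, ∃ i j, i < j ∧ le (f i) (f j))
    (F : Q → Set Q) (hF : ∀ x y, le x y → F y ⊆ F x) (hdown : ∀ x, DownCl le (F x)) :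
    (Set.range F).Finite := by
  by_contra hinf
  have emb := Set.Infinite.natEmbedding _ hinf
  choose a ha using fun n => (emb n).2
  have : IsTrans Q le := ⟨htrans⟩
  obtain ⟨g, hg | hg⟩ := exists_increasing_or_nonincreasing_subseq le a
  · have hdiff : ∀ n, ∃ b, b ∈ F (a (g n)) ∧ b ∉ F (a (g (n + 1))) := by
      intro n
      by_contra! h
      have heq : F (a (g n)) = F (a (g (n + 1))) :=
        Set.Subset.antisymm h (hF _ _ (hg n (n + 1) n.lt_succ_self))
      rw [ha, ha] at heq
      have := g.injective (emb.injective (Subtype.ext heq))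
      omega
    choose b hb hb' using hdiff
    obtain ⟨i, j, hij, hle⟩ := hwqo b
    refine hb' i (hdown _ _ _ hle ?_)
    rcases (Nat.succ_le_of_lt hij).eq_or_lt with h | h
    · exact h ▸ hb j
    · exact hF _ _ (hg _ _ h) (hb j)
  · obtain ⟨i, j, hij, hle⟩ := hwqo fun n => a (g n)
    exact hg i j hij hle

/-- In a monoidal wqo with the +-property, a nonempty downward-closed subset of a
product `A•B` is a finite union of products `Aᵢ•Bᵢ` with `Aᵢ ⊆ A`, `Bᵢ ⊆ B`. -/
theorem stmt5 {Q : Type*} (le : Q → Q → Prop) (mul : Q → Q → Q) (e : Q)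
    (hrefl : ∀ x, le x x)
    (htrans : ∀ x y z, le x y → le y z → le x z)
    (hassoc : ∀ p q r, Equi le (mul (mul p q) r) (mul p (mul q r)))
    (hincr : ∀ q p, le q (mul q p))
    (hmono : ∀ q p q' p', le q q' → le p p' → le (mul q p) (mul q' p'))
    (hneut : ∀ q, Equi le (mul e q) q ∧ Equi le (mul q e) q)
    (hplus : ∀ a b c, le c (mul a b) →
      ∃ a' b', le a' a ∧ le b' b ∧ Equi le c (mul a' b'))
    (hwqo : ∀ f : ℕ → Q, ∃ i j, i < j ∧ le (f i) (f j))
    (A B C : Set Q)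
    (hA : A.Nonempty) (hA' : DownCl le A)
    (hB : B.Nonempty) (hB' : DownCl le B)
    (hC : C.Nonempty) (hC' : DownCl le C)
    (hCAB : C ⊆ Bullet le mul A B) :
    ∃ (n : ℕ) (A' B' : Fin n → Set Q),
      (∀ i, (A' i).Nonempty ∧ DownCl le (A' i) ∧ A' i ⊆ A ∧
            (B' i).Nonempty ∧ DownCl le (B' i) ∧ B' i ⊆ B) ∧
      C = ⋃ i, Bullet le mul (A' i) (B' i) := by
  let F : Q → Set Q := fun a => {b | b ∈ B ∧ mul a b ∈ C}
  have hF : ∀ x y, le x y → F y ⊆ F x := fun x y hxy b hb =>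
    ⟨hb.1, hC' _ _ (hmono _ _ _ _ hxy (hrefl b)) hb.2⟩
  have hdown : ∀ x, DownCl le (F x) := fun x q d hqd hd =>
    ⟨hB' _ _ hqd hd.1, hC' _ _ (hmono _ _ _ _ (hrefl x) hqd) hd.2⟩
  let T : Set (Set Q) := {S | S.Nonempty ∧ ∃ a ∈ A, F a = S}
  have hT : T.Finite := (finite_range_of_antitone_downCl le htrans hwqo F hF hdown).subset
    fun S ⟨_, a, _, ha⟩ => ⟨a, ha⟩
  have : Finite T := hT
  obtain ⟨n, ⟨φ⟩⟩ := Finite.exists_equiv_fin T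
  refine ⟨n, fun i => {a | a ∈ A ∧ (φ.symm i : Set Q) ⊆ F a}, fun i => φ.symm i, ?_, ?_⟩
  · intro i
    beta_reduce
    obtain ⟨hne, a, ha, haS⟩ := (φ.symm i).2
    refine ⟨⟨a, ha, haS.ge⟩, ?_, fun x hx => hx.1, hne, haS ▸ hdown a, ?_⟩
    · exact fun q d hqd hd => ⟨hA' _ _ hqd hd.1, hd.2.trans (hF _ _ hqd)⟩
    · exact haS ▸ fun b hb => hb.1
  · apply Set.Subset.antisymm
    · intro c hc
      obtain ⟨a, ha, b, hb, hle⟩ := hCAB hc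
      obtain ⟨a', b', ha', hb', hcab⟩ := hplus a b c hle
      have hbF : b' ∈ F a' := ⟨hB' _ _ hb' hb, hC' _ _ hcab.2 hc⟩
      have haA : a' ∈ A := hA' _ _ ha' ha
      refine Set.mem_iUnion.2 ⟨φ ⟨F a', ⟨b', hbF⟩, a', haA, rfl⟩, a', ?_, b', ?_, hcab.1⟩
      · simpa using haA
      · simpa using hbF
    · refine Set.iUnion_subset fun i => ?_
      rintro z ⟨a, ha, b, hb, hz⟩
      exact hC' _ _ hz (ha.2 hb).2
end

section
/- Let (Q, ≤, ·) be a monoidal quasi-order. If I and J are ideals of Q, then I•J is an ideal of Q. Moreover, if (Q, ≤) is additionally a well quasi-order, then inclusion on the ideals of Q is well-founded: there is no sequence (I_k)_{k ∈ ℕ} of ideals with I_{k+1} ⊊ I_k for all k. -/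
/-- An ideal: a nonempty, downward-closed, upward-directed subset. -/
def IdealSet {Q : Type*} (le : Q → Q → Prop) (S : Set Q) : Prop :=
  S.Nonempty ∧ DownCl le S ∧ ∀ a ∈ S, ∀ b ∈ S, ∃ c ∈ S, le a c ∧ le b c

/-- The product of two ideals is an ideal as soon as the multiplication is monotone. -/
theorem IdealSet.bullet {Q : Type*} {le : Q → Q → Prop} {mul : Q → Q → Q}
    (hrefl : ∀ x, le x x) (htrans : ∀ x y z, le x y → le y z → le x z)
    (hmono : ∀ q p q' p', le q q' → le p p' → le (mul q p) (mul q' p'))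
    {I J : Set Q} (hI : IdealSet le I) (hJ : IdealSet le J) :
    IdealSet le (Bullet le mul I J) := by
  obtain ⟨⟨a, ha⟩, -, hIdir⟩ := hI
  obtain ⟨⟨b, hb⟩, -, hJdir⟩ := hJ
  refine ⟨⟨mul a b, a, ha, b, hb, hrefl _⟩, ?_, ?_⟩
  · rintro q d hqd ⟨x, hx, y, hy, hd⟩
    exact ⟨x, hx, y, hy, htrans _ _ _ hqd hd⟩
  · rintro u ⟨x, hx, y, hy, hu⟩ v ⟨x', hx', y', hy', hv⟩
    obtain ⟨s, hs, hxs, hxs'⟩ := hIdir x hx x' hx'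
    obtain ⟨t, ht, hyt, hyt'⟩ := hJdir y hy y' hy'
    exact ⟨mul s t, ⟨s, hs, t, ht, hrefl _⟩,
      htrans _ _ _ hu (hmono _ _ _ _ hxs hyt), htrans _ _ _ hv (hmono _ _ _ _ hxs' hyt')⟩

/-- In a wqo there is no strictly decreasing sequence of downward-closed sets. -/
theorem not_strictly_decreasing_of_downCl {Q : Type*} {le : Q → Q → Prop}
    (hwqo : ∀ f : ℕ → Q, ∃ i j, i < j ∧ le (f i) (f j))
    {D : ℕ → Set Q} (hD : ∀ k, DownCl le (D k)) : ¬ ∀ k, D (k + 1) ⊂ D k := by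
  intro hlt
  have hanti : Antitone D := antitone_nat_of_succ_le fun k => (hlt k).subset
  choose f hf hf' using fun k => Set.exists_of_ssubset (hlt k)
  obtain ⟨i, j, hij, hle⟩ := hwqo f
  exact hf' i (hD (i + 1) _ _ hle (hanti hij (hf j)))

/-- In a monoidal qo, the product of two ideals is an ideal; moreover, if the order is
a wqo, inclusion on ideals is well-founded. -/
theorem stmt6 {Q : Type*} (le : Q → Q → Prop) (mul : Q → Q → Q) (e : Q)
    (hrefl : ∀ x, le x x)
    (htrans : ∀ x y z, le x y → le y z → le x z)
    (hassoc : ∀ p q r, Equi le (mul (mul p q) r) (mul p (mul q r)))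
    (hincr : ∀ q p, le q (mul q p))
    (hmono : ∀ q p q' p', le q q' → le p p' → le (mul q p) (mul q' p'))
    (hneut : ∀ q, Equi le (mul e q) q ∧ Equi le (mul q e) q) :
    (∀ I J : Set Q, IdealSet le I → IdealSet le J → IdealSet le (Bullet le mul I J)) ∧
    ((∀ f : ℕ → Q, ∃ i j, i < j ∧ le (f i) (f j)) →
      ¬ ∃ I : ℕ → Set Q, (∀ k, IdealSet le (I k)) ∧ ∀ k, I (k + 1) ⊂ I k) := by
  refine ⟨fun I J hI hJ => hI.bullet hrefl htrans hmono hJ, ?_⟩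
  rintro hwqo ⟨I, hI, hlt⟩
  exact not_strictly_decreasing_of_downCl hwqo (fun k => (hI k).2.1) hlt
end

section
/- Let (Q, ≤) be a well quasi-order. Then every nonempty downward-closed subset D of Q is a finite union of ideals: there exist n ∈ ℕ and ideals I₀, …, I_{n−1} of Q with D = ⋃_{i<n} Iᵢ. -/
/-- In a wqo, strict inclusion of downward-closed sets is well-founded. -/
theorem wellFounded_downCl_ssubset {Q : Type*} {le : Q → Q → Prop}
    (hwqo : ∀ f : ℕ → Q, ∃ i j, i < j ∧ le (f i) (f j)) :
    WellFounded fun A B : Set Q => DownCl le A ∧ A ⊂ B := by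
  rw [wellFounded_iff_isEmpty_descending_chain]
  refine ⟨fun ⟨A, hA⟩ => ?_⟩
  have hanti : Antitone A := antitone_nat_of_succ_le fun n => (hA n).2.subset
  choose x hx hx' using fun n => Set.exists_of_ssubset (hA n).2
  obtain ⟨i, j, hij, hle⟩ := hwqo x
  exact hx' i ((hA i).1 _ _ hle (hanti hij (hx j)))

/-- Removing the elements above `a` from a downward-closed set leaves a downward-closed set. -/
theorem DownCl.sep_not_le {Q : Type*} {le : Q → Q → Prop}
    (htrans : ∀ x y z, le x y → le y z → le x z) {D : Set Q} (hD : DownCl le D) (a : Q) :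
    DownCl le {x ∈ D | ¬ le a x} :=
  fun q d hqd hd => ⟨hD q d hqd hd.1, fun h => hd.2 (htrans _ _ _ h hqd)⟩

/-- In a wqo, every downward-closed set is the union of a finite set of ideals. -/
theorem DownCl.exists_finite_sUnion_idealSet {Q : Type*} {le : Q → Q → Prop}
    (hrefl : ∀ x, le x x)
    (htrans : ∀ x y z, le x y → le y z → le x z)
    (hwqo : ∀ f : ℕ → Q, ∃ i j, i < j ∧ le (f i) (f j))
    {D : Set Q} (hD : DownCl le D) :
    ∃ S : Set (Set Q), S.Finite ∧ (∀ I ∈ S, IdealSet le I) ∧ D = ⋃₀ S := by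
  induction D using (wellFounded_downCl_ssubset hwqo).induction with
  | _ D ih =>
    rcases D.eq_empty_or_nonempty with rfl | hne
    · exact ⟨∅, Set.finite_empty, by simp, by simp⟩
    by_cases hdir : ∀ a ∈ D, ∀ b ∈ D, ∃ c ∈ D, le a c ∧ le b c
    · exact ⟨{D}, Set.finite_singleton D, by simpa using ⟨hne, hD, hdir⟩, by simp⟩
    push Not at hdir
    obtain ⟨a, ha, b, hb, hab⟩ := hdir
    have key : ∀ c ∈ D, ∃ S : Set (Set Q), S.Finite ∧ (∀ I ∈ S, IdealSet le I) ∧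
        {x ∈ D | ¬ le c x} = ⋃₀ S := fun c hc =>
      have hdown := hD.sep_not_le htrans c
      ih _ ⟨hdown, ⟨Set.sep_subset _ _, fun h => (h hc).2 (hrefl c)⟩⟩ hdown
    obtain ⟨S, hS, hSI, hSD⟩ := key a ha
    obtain ⟨T, hT, hTI, hTD⟩ := key b hb
    refine ⟨S ∪ T, hS.union hT, fun I hI => hI.elim (hSI I) (hTI I), ?_⟩
    rw [Set.sUnion_union, ← hSD, ← hTD]
    ext x
    have := hab x
    simp only [Set.mem_union, Set.mem_ofPred_eq]
    tauto

/-- In a wqo, every nonempty downward-closed set is a finite union of ideals. -/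
theorem stmt7 {Q : Type*} (le : Q → Q → Prop)
    (hrefl : ∀ x, le x x)
    (htrans : ∀ x y z, le x y → le y z → le x z)
    (hwqo : ∀ f : ℕ → Q, ∃ i j, i < j ∧ le (f i) (f j))
    (D : Set Q) (hD : D.Nonempty) (hD' : DownCl le D) :
    ∃ (n : ℕ) (I : Fin n → Set Q), (∀ i, IdealSet le (I i)) ∧ D = ⋃ i, I i := by
  obtain ⟨S, hS, hSI, hSD⟩ := hD'.exists_finite_sUnion_idealSet hrefl htrans hwqo
  obtain ⟨n, I, -, rfl⟩ := hS.fin_param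
  exact ⟨n, I, fun i => hSI _ ⟨i, rfl⟩, by rw [hSD, Set.sUnion_range]⟩
end

section
/- Let (Q, ≤, ·) be a monoidal well quasi-order with the +-property. Then the ideals of Q have the +-property for • with respect to inclusion: for all ideals I, H, J of Q, if J ⊆ I•H then there exist ideals I' ⊆ I and H' ⊆ H with J = I'•H'. -/
/-- Downward-closed subsets of a well quasi-order are well-founded under strict inclusion. -/
theorem wellFounded_ssubset_downCl {P : Type*} {r : P → P → Prop} (hr : WellQuasiOrdered r) :
    WellFounded fun D E : {D : Set P // DownCl r D} => D.1 ⊂ E.1 := by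
  have hirr : Std.Irrefl fun D E : {D : Set P // DownCl r D} => D.1 ⊂ E.1 :=
    ⟨fun D h => h.ne rfl⟩
  have htr : IsTrans _ fun D E : {D : Set P // DownCl r D} => D.1 ⊂ E.1 :=
    ⟨fun _ _ _ h h' => h.trans h'⟩
  have hso : IsStrictOrder _ fun D E : {D : Set P // DownCl r D} => D.1 ⊂ E.1 := { }
  rw [RelEmbedding.wellFounded_iff_isEmpty]
  refine ⟨fun f => ?_⟩
  have hlt : ∀ {m n}, m < n → (f n).1 ⊂ (f m).1 := fun h => f.map_rel_iff.2 h
  choose x hx hx' using fun n => Set.exists_of_ssubset (hlt (Nat.lt_succ_self n))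
  obtain ⟨i, j, hij, hle⟩ := hr x
  have hsub : (f j).1 ⊆ (f (i + 1)).1 := by
    rcases (Nat.succ_le_of_lt hij).eq_or_lt with h | h
    · exact (congrArg (fun n => (f n).1) h).ge
    · exact (hlt h).subset
  exact hx' i (hsub ((f j).2 _ _ hle (hx j)))

/-- If a directed set `J` is covered by the downward closure of the image of a downward-closed
set `D` in a well quasi-order, then it is so covered by an ideal contained in `D`. -/
theorem exists_idealSet_subset_covering {P Q : Type*} {r : P → P → Prop} {le : Q → Q → Prop}
    (hr : WellQuasiOrdered r) (hrefl : ∀ p, r p p) (hrtrans : ∀ x y z, r x y → r y z → r x z)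
    (htrans : ∀ x y z, le x y → le y z → le x z) (m : P → Q) {J : Set Q} (hJ : IdealSet le J)
    {D : Set P} (hD : DownCl r D) (hcov : ∀ z ∈ J, ∃ p ∈ D, le z (m p)) :
    ∃ K ⊆ D, IdealSet r K ∧ ∀ z ∈ J, ∃ p ∈ K, le z (m p) := by
  obtain ⟨⟨K, hK⟩, ⟨hKD, hKcov⟩, hmin⟩ := (wellFounded_ssubset_downCl hr).has_min
    {E | E.1 ⊆ D ∧ ∀ z ∈ J, ∃ p ∈ E.1, le z (m p)} ⟨⟨D, hD⟩, subset_rfl, hcov⟩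
  refine ⟨K, hKD, ⟨?_, hK, fun p hp q hq => ?_⟩, hKcov⟩
  · obtain ⟨z, hz⟩ := hJ.1
    obtain ⟨p, hp, -⟩ := hKcov z hz
    exact ⟨p, hp⟩
  by_contra! hpq
  have huncov : ∀ p ∈ K, ∃ z ∈ J, ∀ s ∈ K, ¬ r p s → ¬ le z (m s) := by
    intro p hp
    by_contra! hc
    refine hmin ⟨{s | s ∈ K ∧ ¬ r p s}, fun x y hxy hy =>
      ⟨hK x y hxy hy.1, fun h => hy.2 (hrtrans _ _ _ h hxy)⟩⟩ ⟨fun s hs => hKD hs.1, ?_⟩ ?_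
    · intro z hz
      obtain ⟨s, hs, hps, hzs⟩ := hc z hz
      exact ⟨s, ⟨hs, hps⟩, hzs⟩
    · exact ⟨fun s hs => hs.1, fun h => (h hp).2 (hrefl p)⟩
  obtain ⟨x, hx, hx'⟩ := huncov p hp
  obtain ⟨y, hy, hy'⟩ := huncov q hq
  obtain ⟨z, hz, hxz, hyz⟩ := hJ.2.2 x hx y hy
  obtain ⟨s, hs, hzs⟩ := hKcov z hz
  by_cases hps : r p s
  · exact hy' s hs (hpq s hs hps) (htrans _ _ _ hyz hzs)
  · exact hx' s hs hps (htrans _ _ _ hxz hzs)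

/-- In a monoidal wqo with the +-property, the ideals have the +-property for `•`
with respect to inclusion. -/
theorem stmt9 {Q : Type*} (le : Q → Q → Prop) (mul : Q → Q → Q) (e : Q)
    (hrefl : ∀ x, le x x)
    (htrans : ∀ x y z, le x y → le y z → le x z)
    (hassoc : ∀ p q r, Equi le (mul (mul p q) r) (mul p (mul q r)))
    (hincr : ∀ q p, le q (mul q p))
    (hmono : ∀ q p q' p', le q q' → le p p' → le (mul q p) (mul q' p'))
    (hneut : ∀ q, Equi le (mul e q) q ∧ Equi le (mul q e) q)
    (hplus : ∀ a b c, le c (mul a b) →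
      ∃ a' b', le a' a ∧ le b' b ∧ Equi le c (mul a' b'))
    (hwqo : ∀ f : ℕ → Q, ∃ i j, i < j ∧ le (f i) (f j))
    (I H J : Set Q) (hI : IdealSet le I) (hH : IdealSet le H) (hJ : IdealSet le J)
    (hsub : J ⊆ Bullet le mul I H) :
    ∃ I' H' : Set Q, IdealSet le I' ∧ IdealSet le H' ∧ I' ⊆ I ∧ H' ⊆ H ∧
      J = Bullet le mul I' H' := by
  let r : Q × Q → Q × Q → Prop := fun p q => le p.1 q.1 ∧ le p.2 q.2
  have : IsPreorder Q le := { refl := hrefl, trans := htrans }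
  have hr : WellQuasiOrdered r := WellQuasiOrdered.prod hwqo hwqo
  let D : Set (Q × Q) := {p | p.1 ∈ I ∧ p.2 ∈ H ∧ mul p.1 p.2 ∈ J}
  have hD : DownCl r D := fun p q hpq hq =>
    ⟨hI.2.1 _ _ hpq.1 hq.1, hH.2.1 _ _ hpq.2 hq.2.1,
      hJ.2.1 _ _ (hmono _ _ _ _ hpq.1 hpq.2) hq.2.2⟩
  have hcov : ∀ z ∈ J, ∃ p ∈ D, le z (mul p.1 p.2) := by
    intro z hz
    obtain ⟨a, ha, b, hb, hab⟩ := hsub hz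
    obtain ⟨a', b', ha', hb', hz'⟩ := hplus a b z hab
    exact ⟨(a', b'), ⟨hI.2.1 _ _ ha' ha, hH.2.1 _ _ hb' hb, hJ.2.1 _ _ hz'.2 hz⟩, hz'.1⟩
  obtain ⟨K, hKD, ⟨hne, hdown, hdir⟩, hKcov⟩ := exists_idealSet_subset_covering hr
    (fun p => ⟨hrefl _, hrefl _⟩)
    (fun x y z h h' => ⟨htrans _ _ _ h.1 h'.1, htrans _ _ _ h.2 h'.2⟩)
    htrans (fun p => mul p.1 p.2) hJ hD hcov
  refine ⟨Prod.fst '' K, Prod.snd '' K, ⟨hne.image _, ?_, ?_⟩, ⟨hne.image _, ?_, ?_⟩, ?_, ?_, ?_⟩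
  · rintro q _ hq ⟨p, hp, rfl⟩
    exact ⟨(q, p.2), hdown (q, p.2) p ⟨hq, hrefl _⟩ hp, rfl⟩
  · rintro _ ⟨p, hp, rfl⟩ _ ⟨q, hq, rfl⟩
    obtain ⟨s, hs, hps, hqs⟩ := hdir p hp q hq
    exact ⟨s.1, ⟨s, hs, rfl⟩, hps.1, hqs.1⟩
  · rintro q _ hq ⟨p, hp, rfl⟩
    exact ⟨(p.1, q), hdown (p.1, q) p ⟨hrefl _, hq⟩ hp, rfl⟩
  · rintro _ ⟨p, hp, rfl⟩ _ ⟨q, hq, rfl⟩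
    obtain ⟨s, hs, hps, hqs⟩ := hdir p hp q hq
    exact ⟨s.2, ⟨s, hs, rfl⟩, hps.2, hqs.2⟩
  · rintro _ ⟨p, hp, rfl⟩
    exact (hKD hp).1
  · rintro _ ⟨p, hp, rfl⟩
    exact (hKD hp).2.1
  · ext z
    constructor
    · intro hz
      obtain ⟨p, hp, hzp⟩ := hKcov z hz
      exact ⟨p.1, ⟨p, hp, rfl⟩, p.2, ⟨p, hp, rfl⟩, hzp⟩
    · rintro ⟨_, ⟨p, hp, rfl⟩, _, ⟨q, hq, rfl⟩, hz⟩
      obtain ⟨s, hs, hps, hqs⟩ := hdir p hp q hq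
      exact hJ.2.1 _ _ (htrans _ _ _ hz (hmono _ _ _ _ hps.1 hqs.2)) (hKD hs).2.2
end

section
/- Let (Q, ≤, ·) be a monoidal quasi-order with the +-property and neutral element e such that the strict relation x < y ↔ (x ≤ y ∧ ¬ y ≤ x) is well-founded, and let D ⊆ Q be downward-closed. Then (prim(Q) ∩ D)* is an ideal of Q: it is nonempty, downward-closed, and upward-directed. -/
/-- `A*`: the set of elements equivalent to finite products of elements of `A`,
with the empty product being `e`. -/
def StarSet {Q : Type*} (le : Q → Q → Prop) (mul : Q → Q → Q) (e : Q) (A : Set Q) :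
    Set Q :=
  {q : Q | ∃ l : List Q, (∀ a ∈ l, a ∈ A) ∧ Equi le q (ProdL mul e l)}

/-- `(Q, le, mul, e)` is a monoidal quasi-order. -/
structure IsMonoidalQO {Q : Type*} (le : Q → Q → Prop) (mul : Q → Q → Q) (e : Q) : Prop where
  refl : ∀ x, le x x
  trans : ∀ x y z, le x y → le y z → le x z
  assoc : ∀ p q r, Equi le (mul (mul p q) r) (mul p (mul q r))
  incr : ∀ q p, le q (mul q p)
  mono : ∀ q p q' p', le q q' → le p p' → le (mul q p) (mul q' p')
  neut : ∀ q, Equi le (mul e q) q ∧ Equi le (mul q e) q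

namespace IsMonoidalQO

variable {Q : Type*} {le : Q → Q → Prop} {mul : Q → Q → Q} {e : Q}

theorem equi_trans (h : IsMonoidalQO le mul e) {x y z : Q} (hxy : Equi le x y)
    (hyz : Equi le y z) : Equi le x z :=
  ⟨h.trans _ _ _ hxy.1 hyz.1, h.trans _ _ _ hyz.2 hxy.2⟩

theorem equi_mul (h : IsMonoidalQO le mul e) {x y x' y' : Q} (hx : Equi le x x')
    (hy : Equi le y y') : Equi le (mul x y) (mul x' y') :=
  ⟨h.mono _ _ _ _ hx.1 hy.1, h.mono _ _ _ _ hx.2 hy.2⟩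

theorem bot_le (h : IsMonoidalQO le mul e) (q : Q) : le e q :=
  h.trans _ _ _ (h.incr e q) (h.neut q).1.1

theorem le_mul_left (h : IsMonoidalQO le mul e) (q p : Q) : le p (mul q p) :=
  h.trans _ _ _ (h.neut p).1.2 (h.mono _ _ _ _ (h.bot_le q) (h.refl p))

theorem prodL_cons (h : IsMonoidalQO le mul e) (a : Q) (l : List Q) :
    Equi le (ProdL mul e (a :: l)) (mul a (ProdL mul e l)) := by
  cases l with
  | nil => exact (h.neut a).2.symm
  | cons b l => exact ⟨h.refl _, h.refl _⟩

theorem prodL_append (h : IsMonoidalQO le mul e) (l l' : List Q) :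
    Equi le (ProdL mul e (l ++ l')) (mul (ProdL mul e l) (ProdL mul e l')) := by
  induction l with
  | nil => exact (h.neut _).1.symm
  | cons a l ih =>
    have step := h.equi_trans (h.prodL_cons a (l ++ l')) (h.equi_mul ⟨h.refl a, h.refl a⟩ ih)
    exact h.equi_trans (h.equi_trans step (h.assoc _ _ _).symm)
      (h.equi_mul (h.prodL_cons a l).symm ⟨h.refl _, h.refl _⟩)

theorem starSet_of_equi_mul (h : IsMonoidalQO le mul e) {A : Set Q} {q a b : Q}
    (hq : Equi le q (mul a b)) (ha : a ∈ StarSet le mul e A) (hb : b ∈ StarSet le mul e A) :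
    q ∈ StarSet le mul e A := by
  obtain ⟨l, hl, hal⟩ := ha
  obtain ⟨l', hl', hbl⟩ := hb
  refine ⟨l ++ l', fun x hx => (List.mem_append.1 hx).elim (hl x) (hl' x), ?_⟩
  exact h.equi_trans hq (h.equi_trans (h.equi_mul hal hbl) (h.prodL_append l l').symm)

/-- Every element of a downward-closed set is a product of primes from that set. -/
theorem subset_starSet_prime (h : IsMonoidalQO le mul e)
    (hwf : WellFounded (fun x y => le x y ∧ ¬ le y x)) {D : Set Q} (hD : DownCl le D) :
    D ⊆ StarSet le mul e {p : Q | PrimeEl le mul e p ∧ p ∈ D} := by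
  intro q
  induction q using hwf.induction with
  | _ q ih =>
    intro hq
    by_cases he : Equi le q e
    · exact ⟨[], by simp, he⟩
    by_cases hp : PrimeEl le mul e q
    · exact ⟨[q], by simpa using ⟨hp, hq⟩, h.refl q, h.refl q⟩
    obtain ⟨a, b, hab, hna, hnb⟩ :
        ∃ a b, Equi le q (mul a b) ∧ ¬ Equi le q a ∧ ¬ Equi le q b := by
      by_contra hcon
      refine hp ⟨he, fun a b hab => ?_⟩
      by_contra hor
      exact hcon ⟨a, b, hab, not_or.1 hor⟩
    have ha : le a q := h.trans _ _ _ (h.incr a b) hab.2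
    have hb : le b q := h.trans _ _ _ (h.le_mul_left a b) hab.2
    exact h.starSet_of_equi_mul hab
      (ih a ⟨ha, fun hqa => hna ⟨hqa, ha⟩⟩ (hD _ _ ha hq))
      (ih b ⟨hb, fun hqb => hnb ⟨hqb, hb⟩⟩ (hD _ _ hb hq))

/-- Under the +-property, an element below a product of elements of a downward-closed set `D`
is a product of primes from `D`. -/
theorem mem_starSet_prime_of_le_prodL (h : IsMonoidalQO le mul e)
    (hplus : ∀ a b c, le c (mul a b) →
      ∃ a' b', le a' a ∧ le b' b ∧ Equi le c (mul a' b'))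
    (hwf : WellFounded (fun x y => le x y ∧ ¬ le y x)) {D : Set Q} (hD : DownCl le D)
    {l : List Q} (hl : ∀ a ∈ l, a ∈ D) {c : Q} (hc : le c (ProdL mul e l)) :
    c ∈ StarSet le mul e {p : Q | PrimeEl le mul e p ∧ p ∈ D} := by
  induction l generalizing c with
  | nil => exact ⟨[], by simp, hc, h.bot_le c⟩
  | cons a l ih =>
    obtain ⟨a', b', ha, hb, hab⟩ := hplus _ _ c (h.trans _ _ _ hc (h.prodL_cons a l).1)
    exact h.starSet_of_equi_mul hab
      (h.subset_starSet_prime hwf hD (hD _ _ ha (hl a (by simp))))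
      (ih (fun x hx => hl x (List.mem_cons_of_mem a hx)) hb)

end IsMonoidalQO

/-- In a monoidal qo with the +-property whose strict order is well-founded,
`(prim(Q) ∩ D)*` is an ideal for every downward-closed `D`. -/
theorem stmt11 {Q : Type*} (le : Q → Q → Prop) (mul : Q → Q → Q) (e : Q)
    (hrefl : ∀ x, le x x)
    (htrans : ∀ x y z, le x y → le y z → le x z)
    (hassoc : ∀ p q r, Equi le (mul (mul p q) r) (mul p (mul q r)))
    (hincr : ∀ q p, le q (mul q p))
    (hmono : ∀ q p q' p', le q q' → le p p' → le (mul q p) (mul q' p'))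
    (hneut : ∀ q, Equi le (mul e q) q ∧ Equi le (mul q e) q)
    (hplus : ∀ a b c, le c (mul a b) →
      ∃ a' b', le a' a ∧ le b' b ∧ Equi le c (mul a' b'))
    (hwf : WellFounded (fun x y => le x y ∧ ¬ le y x))
    (D : Set Q) (hD : DownCl le D) :
    IdealSet le (StarSet le mul e {p : Q | PrimeEl le mul e p ∧ p ∈ D}) := by
  have h : IsMonoidalQO le mul e := ⟨hrefl, htrans, hassoc, hincr, hmono, hneut⟩
  refine ⟨⟨e, [], by simp, hrefl e, hrefl e⟩, ?_, fun a ha b hb =>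
    ⟨mul a b, h.starSet_of_equi_mul ⟨hrefl _, hrefl _⟩ ha hb, hincr a b, h.le_mul_left a b⟩⟩
  rintro q d hqd ⟨l, hl, hdl⟩
  exact h.mem_starSet_prime_of_le_prodL hplus hwf hD (fun a ha => (hl a ha).2)
    (htrans _ _ _ hqd hdl.1)
end

section
/- Let (Q, ≤, ·) be a monoidal quasi-order with the property that for every x, y, w, z ∈ Q, x·y ≤ w·z implies x ≤ w or y ≤ z. Then for all ideals X, Y, W, Z of Q, X•Y ⊆ W•Z implies X ⊆ W or Y ⊆ Z. -/
/-- If in a monoidal qo `x·y ≤ w·z` implies `x ≤ w` or `y ≤ z`, then for ideals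
`X•Y ⊆ W•Z` implies `X ⊆ W` or `Y ⊆ Z`. -/
theorem stmt12 {Q : Type*} (le : Q → Q → Prop) (mul : Q → Q → Q) (e : Q)
    (hrefl : ∀ x, le x x)
    (htrans : ∀ x y z, le x y → le y z → le x z)
    (hassoc : ∀ p q r, Equi le (mul (mul p q) r) (mul p (mul q r)))
    (hincr : ∀ q p, le q (mul q p))
    (hmono : ∀ q p q' p', le q q' → le p p' → le (mul q p) (mul q' p'))
    (hneut : ∀ q, Equi le (mul e q) q ∧ Equi le (mul q e) q)
    (hsplit : ∀ x y w z, le (mul x y) (mul w z) → le x w ∨ le y z)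
    (X Y W Z : Set Q)
    (hX : IdealSet le X) (hY : IdealSet le Y) (hW : IdealSet le W) (hZ : IdealSet le Z)
    (hsub : Bullet le mul X Y ⊆ Bullet le mul W Z) :
    X ⊆ W ∨ Y ⊆ Z := by
  by_contra! h
  obtain ⟨⟨x, hxX, hxW⟩, y, hyY, hyZ⟩ := h.imp Set.not_subset.mp Set.not_subset.mp
  obtain ⟨w, hw, z, hz, hle⟩ := hsub ⟨x, hxX, y, hyY, hrefl (mul x y)⟩
  rcases hsplit x y w z hle with hxw | hyz
  · exact hxW (hW.2.1 x w hxw hw)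
  · exact hyZ (hZ.2.1 y z hyz hz)
end

section
/- Let (P, ≤_P) be a quasi-order, P_n ⊆ P downward-closed and P_i = P ∖ P_n. In the monoidal quasi-order H(P, P_n, P_i) of finite sequences over P with the generalized Higman ordering ≤_H and concatenation, a sequence u is prime if and only if u is ≡_H-equivalent to a one-element sequence ⟨p⟩ with p ∈ P. -/
/-- The generalized Higman ordering on finite sequences over a qo `(P, leP)`,
where collapsing several indices to `j` is allowed only if `v j ∈ Pi`. -/
def HigLE {P : Type*} (leP : P → P → Prop) (Pi : Set P) (u v : List P) : Prop :=
  ∃ f : Fin u.length → Fin v.length, Monotone f ∧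
    (∀ i, leP (u.get i) (v.get (f i))) ∧
    ∀ j, (∃ i i', i ≠ i' ∧ f i = j ∧ f i' = j) → v.get j ∈ Pi

/-- The equivalence induced by the generalized Higman ordering. -/
def HigEquiv {P : Type*} (leP : P → P → Prop) (Pi : Set P) (u v : List P) : Prop :=
  HigLE leP Pi u v ∧ HigLE leP Pi v u

/-- A sequence is prime in `H(P, P_n, P_i)` if it is not equivalent to the empty
sequence and `u ≡_H v⌢w` implies `u ≡_H v` or `u ≡_H w`. -/
def HigPrime {P : Type*} (leP : P → P → Prop) (Pi : Set P) (u : List P) : Prop :=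
  ¬ HigEquiv leP Pi u [] ∧
    ∀ v w : List P, HigEquiv leP Pi u (v ++ w) → HigEquiv leP Pi u v ∨ HigEquiv leP Pi u w

section Higman

variable {P : Type*} {leP : P → P → Prop} {Pi : Set P}

theorem HigLE.trans (htrans : ∀ x y z, leP x y → leP y z → leP x z)
    (hup : ∀ x y, leP x y → x ∈ Pi → y ∈ Pi) {u v w : List P}
    (huv : HigLE leP Pi u v) (hvw : HigLE leP Pi v w) : HigLE leP Pi u w := by
  obtain ⟨f, hf, hfle, hfPi⟩ := huv
  obtain ⟨g, hg, hgle, hgPi⟩ := hvw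
  refine ⟨g ∘ f, hg.comp hf, fun i => htrans _ _ _ (hfle i) (hgle (f i)), ?_⟩
  rintro j ⟨i, i', hne, rfl, hi'⟩
  by_cases h : f i = f i'
  · exact hup _ _ (hgle (f i)) (hfPi (f i) ⟨i, i', hne, rfl, h.symm⟩)
  · exact hgPi _ ⟨f i, f i', h, rfl, hi'⟩

theorem HigLE.append_right (hrefl : ∀ x, leP x x) (v w : List P) :
    HigLE leP Pi v (v ++ w) := by
  refine ⟨fun i => ⟨i, by simp; omega⟩, fun i j h => h, fun i => ?_, ?_⟩
  · simpa using hrefl _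
  · rintro j ⟨i, i', hne, rfl, h⟩
    exact absurd (Fin.ext (by simpa using h.symm)) hne

theorem HigLE.append_left (hrefl : ∀ x, leP x x) (v w : List P) :
    HigLE leP Pi w (v ++ w) := by
  refine ⟨fun i => ⟨v.length + i, by simp⟩, fun i j h => ?_, fun i => ?_, ?_⟩
  · simpa using h
  · simpa using hrefl _
  · rintro j ⟨i, i', hne, rfl, h⟩
    exact absurd (Fin.ext (by simpa using h.symm)) hne

theorem higLE_singleton_iff {p : P} {v : List P} :
    HigLE leP Pi [p] v ↔ ∃ q ∈ v, leP p q := by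
  constructor
  · rintro ⟨f, -, hle, -⟩
    exact ⟨_, List.get_mem v (f ⟨0, by simp⟩), hle ⟨0, by simp⟩⟩
  · rintro ⟨q, hq, hpq⟩
    obtain ⟨n, rfl⟩ := List.mem_iff_get.1 hq
    refine ⟨fun _ => n, fun _ _ _ => le_rfl, fun i => ?_, ?_⟩
    · simpa using hpq
    · rintro j ⟨i, i', hne, -⟩
      exact absurd (Fin.ext (by simp)) hne

theorem HigPrime.exists_singleton_of_higEquiv {u : List P} (hu : HigPrime leP Pi u) :
    ∀ v : List P, HigEquiv leP Pi u v → ∃ p : P, HigEquiv leP Pi u [p]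
  | [], h => absurd h hu.1
  | a :: t, h => (hu.2 [a] t h).elim (fun ha => ⟨a, ha⟩)
      (hu.exists_singleton_of_higEquiv t)

theorem HigEquiv.refl (hrefl : ∀ x, leP x x) (u : List P) : HigEquiv leP Pi u u := by
  have h : HigLE leP Pi u u := HigLE.append_left hrefl [] u
  exact ⟨h, h⟩

theorem higPrime_of_higEquiv_singleton (hrefl : ∀ x, leP x x)
    (htrans : ∀ x y z, leP x y → leP y z → leP x z)
    (hup : ∀ x y, leP x y → x ∈ Pi → y ∈ Pi) {u : List P} {p : P}
    (hu : HigEquiv leP Pi u [p]) : HigPrime leP Pi u := by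
  refine ⟨fun h => ?_, fun v w h => ?_⟩
  · obtain ⟨q, hq, -⟩ := higLE_singleton_iff.1 (hu.2.trans htrans hup h.1)
    simp at hq
  · obtain ⟨q, hq, hpq⟩ := higLE_singleton_iff.1 (hu.2.trans htrans hup h.1)
    rcases List.mem_append.1 hq with hq | hq
    · exact .inl ⟨hu.1.trans htrans hup (higLE_singleton_iff.2 ⟨q, hq, hpq⟩),
        (HigLE.append_right hrefl v w).trans htrans hup h.2⟩
    · exact .inr ⟨hu.1.trans htrans hup (higLE_singleton_iff.2 ⟨q, hq, hpq⟩),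
        (HigLE.append_left hrefl v w).trans htrans hup h.2⟩

end Higman

/-- In `H(P, P_n, P_i)`, a sequence is prime iff it is `≡_H`-equivalent to a
one-element sequence. -/
theorem stmt15 {P : Type*} (leP : P → P → Prop)
    (hrefl : ∀ x, leP x x)
    (htrans : ∀ x y z, leP x y → leP y z → leP x z)
    (Pn : Set P) (hPn : ∀ q d, leP q d → d ∈ Pn → q ∈ Pn)
    (Pi : Set P) (hPi : Pi = Pnᶜ) :
    ∀ u : List P, HigPrime leP Pi u ↔ ∃ p : P, HigEquiv leP Pi u [p] := by
  have hup : ∀ x y, leP x y → x ∈ Pi → y ∈ Pi := by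
    subst hPi
    exact fun x y hxy hx hy => hx (hPn x y hxy hy)
  exact fun u => ⟨fun hu => hu.exists_singleton_of_higEquiv u (.refl hrefl u),
    fun ⟨_, hp⟩ => higPrime_of_higEquiv_singleton hrefl htrans hup hp⟩
end

section
/- Let (Q, ≤, ·) be an abstractly Higman monoidal well-founded quasi-order. Then for all x, y, w, z ∈ Q, x·y ≤ w·z implies x ≤ w or y ≤ z. -/
/-- A monoidal qo is abstractly Higman if products of primes compare exactly via
weakly increasing maps that only collapse indices at idempotent primes. -/
def AbsHig {Q : Type*} (le : Q → Q → Prop) (mul : Q → Q → Q) (e : Q) : Prop :=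
  ∀ (n m : ℕ) (p : Fin (n + 1) → Q) (q : Fin (m + 1) → Q),
    (∀ i, PrimeEl le mul e (p i)) → (∀ j, PrimeEl le mul e (q j)) →
    (le (ProdL mul e (List.ofFn p)) (ProdL mul e (List.ofFn q)) ↔
      ∃ h : Fin (n + 1) → Fin (m + 1), Monotone h ∧ (∀ i, le (p i) (q (h i))) ∧
        ∀ j, (∃ i i', i ≠ i' ∧ h i = j ∧ h i' = j) → Equi le (mul (q j) (q j)) (q j))

theorem Equi.mul_congr {Q : Type*} {le : Q → Q → Prop} {mul : Q → Q → Q}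
    (hmono : ∀ q p q' p', le q q' → le p p' → le (mul q p) (mul q' p')) {a b c d : Q}
    (hac : Equi le a c) (hbd : Equi le b d) : Equi le (mul a b) (mul c d) :=
  ⟨hmono _ _ _ _ hac.1 hbd.1, hmono _ _ _ _ hac.2 hbd.2⟩

theorem Equi.symm {Q : Type*} {le : Q → Q → Prop} {x y : Q} (h : Equi le x y) : Equi le y x :=
  And.symm h

/-- The product of a concatenation is the product of the products, up to equivalence. -/
theorem equi_prodL_append {Q : Type*} {le : Q → Q → Prop} {mul : Q → Q → Q} {e : Q}
    (hrefl : ∀ x, le x x)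
    (htrans : ∀ x y z, le x y → le y z → le x z)
    (hassoc : ∀ p q r, Equi le (mul (mul p q) r) (mul p (mul q r)))
    (hmono : ∀ q p q' p', le q q' → le p p' → le (mul q p) (mul q' p'))
    (hneut : ∀ q, Equi le (mul e q) q ∧ Equi le (mul q e) q) (l₁ l₂ : List Q) :
    Equi le (ProdL mul e (l₁ ++ l₂)) (mul (ProdL mul e l₁) (ProdL mul e l₂)) := by
  have hcons : ∀ (a : Q) (l : List Q),
      Equi le (ProdL mul e (a :: l)) (mul a (ProdL mul e l)) := by
    intro a l
    cases l with
    | nil => exact (hneut a).2.symm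
    | cons b l => exact ⟨hrefl _, hrefl _⟩
  induction l₁ with
  | nil => exact (hneut _).1.symm
  | cons a l ih =>
    have hright : Equi le (mul a (ProdL mul e (l ++ l₂)))
        (mul a (mul (ProdL mul e l) (ProdL mul e l₂))) :=
      Equi.mul_congr hmono ⟨hrefl a, hrefl a⟩ ih
    have hleft : Equi le (mul (mul a (ProdL mul e l)) (ProdL mul e l₂))
        (mul (ProdL mul e (a :: l)) (ProdL mul e l₂)) :=
      Equi.mul_congr hmono (hcons a l).symm ⟨hrefl _, hrefl _⟩
    exact ((hcons a (l ++ l₂)).trans_of htrans hright).trans_of htrans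
      ((hassoc _ _ _).symm.trans_of htrans hleft)

/-- Every element not equivalent to `e` is equivalent to a nonempty product of primes. -/
theorem exists_equi_prodL_prime {Q : Type*} {le : Q → Q → Prop} {mul : Q → Q → Q} {e : Q}
    (hrefl : ∀ x, le x x)
    (htrans : ∀ x y z, le x y → le y z → le x z)
    (hassoc : ∀ p q r, Equi le (mul (mul p q) r) (mul p (mul q r)))
    (hincr : ∀ q p, le q (mul q p))
    (hmono : ∀ q p q' p', le q q' → le p p' → le (mul q p) (mul q' p'))
    (hneut : ∀ q, Equi le (mul e q) q ∧ Equi le (mul q e) q)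
    (hwf : WellFounded (fun x y => le x y ∧ ¬ le y x)) (x : Q) (hx : ¬ Equi le x e) :
    ∃ (n : ℕ) (p : Fin (n + 1) → Q), (∀ i, PrimeEl le mul e (p i)) ∧
      Equi le x (ProdL mul e (List.ofFn p)) := by
  induction x using hwf.induction with
  | _ x ih =>
  by_cases hp : PrimeEl le mul e x
  · exact ⟨0, fun _ => x, fun _ => hp, hrefl x, hrefl x⟩
  · simp only [PrimeEl, hx, not_false_eq_true, true_and, not_forall, not_or] at hp
    obtain ⟨a, b, hab, hxa, hxb⟩ := hp
    have hax : le a x := htrans _ _ _ (hincr a b) hab.2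
    have hbx : le b x := htrans _ _ _ (htrans _ _ _ (hneut b).1.2
      (hmono _ _ _ _ (htrans _ _ _ (hincr e a) (hneut a).1.1) (hrefl b))) hab.2
    have hae : ¬ Equi le a e := fun h => hxb <| hab.trans_of htrans <|
      (Equi.mul_congr hmono h ⟨hrefl b, hrefl b⟩).trans_of htrans (hneut b).1
    have hbe : ¬ Equi le b e := fun h => hxa <| hab.trans_of htrans <|
      (Equi.mul_congr hmono ⟨hrefl a, hrefl a⟩ h).trans_of htrans (hneut a).2
    obtain ⟨n, p, hp, hpa⟩ := ih a ⟨hax, fun h => hxa ⟨h, hax⟩⟩ hae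
    obtain ⟨m, q, hq, hqb⟩ := ih b ⟨hbx, fun h => hxb ⟨h, hbx⟩⟩ hbe
    refine ⟨n + 1 + m, Fin.append (m := n + 1) (n := m + 1) p q, ?_, ?_⟩
    · exact fun i => Fin.addCases (m := n + 1) (n := m + 1)
        (fun i => by simpa using hp i) (fun i => by simpa using hq i) i
    · have happ := equi_prodL_append hrefl htrans hassoc hmono hneut
        (List.ofFn p) (List.ofFn q)
      rw [← List.ofFn_fin_append] at happ
      exact hab.trans_of htrans <| (Equi.mul_congr hmono hpa hqb).trans_of htrans happ.symm

/-- A Higman embedding between concatenations restricts to one between the left parts or to one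
between the right parts. -/
theorem AbsHig.le_or_le_of_append {Q : Type*} {le : Q → Q → Prop} {mul : Q → Q → Q} {e : Q}
    (hhig : AbsHig le mul e) {n m k l : ℕ}
    {p : Fin (n + 1) → Q} {p' : Fin (m + 1) → Q} {q : Fin (k + 1) → Q} {q' : Fin (l + 1) → Q}
    (hp : ∀ i, PrimeEl le mul e (p i)) (hp' : ∀ i, PrimeEl le mul e (p' i))
    (hq : ∀ i, PrimeEl le mul e (q i)) (hq' : ∀ i, PrimeEl le mul e (q' i))
    (hle : le (ProdL mul e (List.ofFn (Fin.append p p')))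
      (ProdL mul e (List.ofFn (Fin.append q q')))) :
    le (ProdL mul e (List.ofFn p)) (ProdL mul e (List.ofFn q)) ∨
      le (ProdL mul e (List.ofFn p')) (ProdL mul e (List.ofFn q')) := by
  have hprime : ∀ {a b : ℕ} {f : Fin a → Q} {g : Fin b → Q}, (∀ i, PrimeEl le mul e (f i)) →
      (∀ i, PrimeEl le mul e (g i)) → ∀ i, PrimeEl le mul e (Fin.append f g i) :=
    fun hf hg i => Fin.addCases (fun i => by simpa using hf i) (fun i => by simpa using hg i) i
  obtain ⟨h, hmon, hcomp, hidem⟩ :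
      ∃ h : Fin (n + 1 + (m + 1)) → Fin (k + 1 + (l + 1)), Monotone h ∧
        (∀ i, le (Fin.append p p' i) (Fin.append q q' (h i))) ∧
        ∀ j, (∃ i i', i ≠ i' ∧ h i = j ∧ h i' = j) →
          Equi le (mul (Fin.append q q' j) (Fin.append q q' j)) (Fin.append q q' j) :=
    (hhig (n + 1 + m) (k + 1 + l) _ _ (hprime (a := n + 1) (b := m + 1) hp hp')
      (hprime (a := k + 1) (b := l + 1) hq hq')).1 hle
  by_cases hlast : (h (Fin.castAdd (m + 1) (Fin.last n))).val < k + 1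
  · left
    have hex : ∀ i : Fin (n + 1), ∃ j : Fin (k + 1),
        h (Fin.castAdd (m + 1) i) = Fin.castAdd (l + 1) j := by
      intro i
      have hi : h (Fin.castAdd (m + 1) i) ≤ h (Fin.castAdd (m + 1) (Fin.last n)) :=
        hmon (Fin.le_def.2 (Fin.le_def.1 (Fin.le_last i)))
      exact ⟨⟨_, lt_of_le_of_lt (Fin.le_def.1 hi) hlast⟩, rfl⟩
    choose g hg using hex
    refine (hhig n k p q hp hq).2 ⟨g, ?_, ?_, ?_⟩
    · intro i i' hii
      have hle' : h (Fin.castAdd (m + 1) i) ≤ h (Fin.castAdd (m + 1) i') :=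
        hmon (Fin.le_def.2 (Fin.le_def.1 hii))
      rw [hg, hg] at hle'
      exact hle'
    · intro i
      simpa [hg] using hcomp (Fin.castAdd (m + 1) i)
    · rintro j ⟨i, i', hne, hi, hi'⟩
      simpa using hidem (Fin.castAdd (l + 1) j) ⟨Fin.castAdd (m + 1) i, Fin.castAdd (m + 1) i',
        fun heq => hne (Fin.castAdd_injective _ _ heq), by rw [hg, hi], by rw [hg, hi']⟩
  · right
    have hex : ∀ i : Fin (m + 1), ∃ j : Fin (l + 1),
        h (Fin.natAdd (n + 1) i) = Fin.natAdd (k + 1) j := by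
      intro i
      have hi : h (Fin.castAdd (m + 1) (Fin.last n)) ≤ h (Fin.natAdd (n + 1) i) :=
        hmon (Fin.le_def.2 (by simp; omega))
      have hi' := Fin.le_def.1 hi
      exact ⟨⟨(h (Fin.natAdd (n + 1) i)).val - (k + 1), by omega⟩, Fin.ext (by simp; omega)⟩
    choose g hg using hex
    refine (hhig m l p' q' hp' hq').2 ⟨g, ?_, ?_, ?_⟩
    · intro i i' hii
      have hle' : h (Fin.natAdd (n + 1) i) ≤ h (Fin.natAdd (n + 1) i') :=
        hmon (by simpa using hii)
      rw [hg, hg] at hle'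
      simpa using hle'
    · intro i
      simpa [hg] using hcomp (Fin.natAdd (n + 1) i)
    · rintro j ⟨i, i', hne, hi, hi'⟩
      simpa using hidem (Fin.natAdd (k + 1) j) ⟨Fin.natAdd (n + 1) i, Fin.natAdd (n + 1) i',
        fun heq => hne (Fin.natAdd_injective _ _ heq), by rw [hg, hi], by rw [hg, hi']⟩

/-- In an abstractly Higman monoidal well-founded qo, `x·y ≤ w·z` implies
`x ≤ w` or `y ≤ z`. -/
theorem stmt17 {Q : Type*} (le : Q → Q → Prop) (mul : Q → Q → Q) (e : Q)
    (hrefl : ∀ x, le x x)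
    (htrans : ∀ x y z, le x y → le y z → le x z)
    (hassoc : ∀ p q r, Equi le (mul (mul p q) r) (mul p (mul q r)))
    (hincr : ∀ q p, le q (mul q p))
    (hmono : ∀ q p q' p', le q q' → le p p' → le (mul q p) (mul q' p'))
    (hneut : ∀ q, Equi le (mul e q) q ∧ Equi le (mul q e) q)
    (hwf : WellFounded (fun x y => le x y ∧ ¬ le y x))
    (hhig : AbsHig le mul e) :
    ∀ x y w z : Q, le (mul x y) (mul w z) → le x w ∨ le y z := by
  have hbot : ∀ q, le e q := fun q => htrans _ _ _ (hincr e q) (hneut q).1.1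
  have hright : ∀ a b, le b (mul a b) := fun a b =>
    htrans _ _ _ (hneut b).1.2 (hmono _ _ _ _ (hbot a) (hrefl b))
  intro x y w z hle
  by_cases hx : Equi le x e
  · exact Or.inl (htrans _ _ _ hx.1 (hbot w))
  by_cases hy : Equi le y e
  · exact Or.inr (htrans _ _ _ hy.1 (hbot z))
  by_cases hw : Equi le w e
  · exact Or.inr (htrans _ _ _ (hright x y) (htrans _ _ _ hle
      (htrans _ _ _ (hmono _ _ _ _ hw.1 (hrefl z)) (hneut z).1.1)))
  by_cases hz : Equi le z e
  · exact Or.inl (htrans _ _ _ (hincr x y) (htrans _ _ _ hle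
      (htrans _ _ _ (hmono _ _ _ _ (hrefl w) hz.1) (hneut w).2.1)))
  have hdecomp := exists_equi_prodL_prime hrefl htrans hassoc hincr hmono hneut hwf
  obtain ⟨n, p, hp, hxp⟩ := hdecomp x hx
  obtain ⟨m, p', hp', hyp⟩ := hdecomp y hy
  obtain ⟨k, q, hq, hwq⟩ := hdecomp w hw
  obtain ⟨l, q', hq', hzq⟩ := hdecomp z hz
  have happ := equi_prodL_append hrefl htrans hassoc hmono hneut
  have hprod : le (ProdL mul e (List.ofFn (Fin.append p p')))
      (ProdL mul e (List.ofFn (Fin.append q q'))) := by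
    rw [List.ofFn_fin_append, List.ofFn_fin_append]
    exact htrans _ _ _ (happ _ _).1 <| htrans _ _ _ (hmono _ _ _ _ hxp.2 hyp.2) <|
      htrans _ _ _ hle <| htrans _ _ _ (hmono _ _ _ _ hwq.1 hzq.1) (happ _ _).2
  exact (hhig.le_or_le_of_append hp hp' hq hq' hprod).imp
    (fun h => htrans _ _ _ hxp.1 (htrans _ _ _ h hwq.2))
    (fun h => htrans _ _ _ hyp.1 (htrans _ _ _ h hzq.2))
end

section
/- Let (Q, ≤, ·) be an abstractly Higman monoidal well-founded quasi-order, and let p, q ∈ Q be primes with p ≤ q. If p is idempotent (p·p ≡ p), then q is idempotent (q·q ≡ q). -/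
/-- In an abstractly Higman monoidal well-founded qo, a prime above an idempotent
prime is idempotent. -/
theorem stmt18 {Q : Type*} (le : Q → Q → Prop) (mul : Q → Q → Q) (e : Q)
    (hrefl : ∀ x, le x x)
    (htrans : ∀ x y z, le x y → le y z → le x z)
    (hassoc : ∀ p q r, Equi le (mul (mul p q) r) (mul p (mul q r)))
    (hincr : ∀ q p, le q (mul q p))
    (hmono : ∀ q p q' p', le q q' → le p p' → le (mul q p) (mul q' p'))
    (hneut : ∀ q, Equi le (mul e q) q ∧ Equi le (mul q e) q)
    (hwf : WellFounded (fun x y => le x y ∧ ¬ le y x))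
    (hhig : AbsHig le mul e)
    (p q : Q) (hp : PrimeEl le mul e p) (hq : PrimeEl le mul e q)
    (hpq : le p q) (hidem : Equi le (mul p p) p) :
    Equi le (mul q q) q := by
  have hprod : le (ProdL mul e (List.ofFn fun _ : Fin 2 => p))
      (ProdL mul e (List.ofFn fun _ : Fin 1 => q)) := by
    simpa [List.ofFn_succ, ProdL] using htrans _ _ _ hidem.1 hpq
  obtain ⟨h, -, -, hcollapse⟩ :=
    (hhig 1 0 (fun _ => p) (fun _ => q) (fun _ => hp) (fun _ => hq)).1 hprod
  exact hcollapse 0 ⟨0, 1, by decide, Fin.fin_one_eq_zero _, Fin.fin_one_eq_zero _⟩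
end
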